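/- Let c > 0. For the urn process (U_k) with parameters n and p = c/n, the variance of U_k/√n satisfies: there exists a constant C > 0 (depending only on c) such that for all integers n > 2c and all 0 ≤ k ≤ n, |Var(U_k)/n − e^{−ck/n}(1 − e^{−ck/n})| ≤ C/n. -/

import Mathlib

open MeasureTheory ProbabilityTheory Filter

/-- The probability that a Binomial(N, p) random variable takes the value `j`. -/
noncomputable def binomialProb (N : ℕ) (p : ℝ) (j : ℕ) : ℝ :=
  (N.choose j : ℝ) * p ^ j * (1 - p) ^ (N - j)

/-- `U` is an urn process with parameters `n` and `p`: it starts at `n`, is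
(pointwise a.s.) nonincreasing, and conditionally on `U 0, …, U k` the decrement
`U k - U (k+1)` has a Binomial(`U k`, `p`) distribution. -/
def IsUrnProcess {Ω : Type*} [MeasurableSpace Ω] (μ : Measure Ω)
    (n : ℕ) (p : ℝ) (U : ℕ → Ω → ℕ)
    (hU : ∀ i, StronglyMeasurable (U i)) : Prop :=
  (∀ᵐ ω ∂μ, U 0 ω = n) ∧
  (∀ k, ∀ᵐ ω ∂μ, U (k + 1) ω ≤ U k ω) ∧
  (∀ k j, μ[Set.indicator {ω | U k ω - U (k + 1) ω = j} (fun _ => (1 : ℝ)) |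
      MeasureTheory.Filtration.natural U hU k]
    =ᵐ[μ] fun ω => binomialProb (U k ω) p j)

/-- The number of balls that survive one step of a Binomial removal has mean `m * (1 - p)`. -/
theorem sum_sub_mul_binomialProb (m : ℕ) (p : ℝ) :
    ∑ j ∈ Finset.range (m + 1), ((m - j : ℕ) : ℝ) * binomialProb m p j = (1 - p) * m := by
  have h := congrArg (Polynomial.eval (1 - p)) (bernsteinPolynomial.sum_smul ℝ m)
  rw [← Finset.sum_range_reflect] at h
  simp only [Polynomial.eval_finsetSum, bernsteinPolynomial, nsmul_eq_mul, Polynomial.eval_mul,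
    Polynomial.eval_natCast, Polynomial.eval_pow, Polynomial.eval_X, Polynomial.eval_sub,
    Polynomial.eval_one] at h
  rw [mul_comm, ← h]
  refine Finset.sum_congr rfl fun j hj => ?_
  have hj' : j ≤ m := Nat.lt_succ_iff.mp (Finset.mem_range.mp hj)
  rw [show m + 1 - 1 - j = m - j by omega, Nat.choose_symm hj', Nat.sub_sub_self hj',
    binomialProb]
  ring

/-- Second factorial moment of the number of balls that survive one Binomial removal. -/
theorem sum_factorial_moment_mul_binomialProb (m : ℕ) (p : ℝ) :
    ∑ j ∈ Finset.range (m + 1), (((m - j) * (m - j - 1) : ℕ) : ℝ) * binomialProb m p j =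
      (1 - p) ^ 2 * ((m * (m - 1) : ℕ) : ℝ) := by
  have h := congrArg (Polynomial.eval (1 - p)) (bernsteinPolynomial.sum_mul_smul ℝ m)
  rw [← Finset.sum_range_reflect] at h
  simp only [Polynomial.eval_finsetSum, bernsteinPolynomial, nsmul_eq_mul, Polynomial.eval_mul,
    Polynomial.eval_natCast, Polynomial.eval_pow, Polynomial.eval_X, Polynomial.eval_sub,
    Polynomial.eval_one] at h
  rw [mul_comm, ← h]
  refine Finset.sum_congr rfl fun j hj => ?_
  have hj' : j ≤ m := Nat.lt_succ_iff.mp (Finset.mem_range.mp hj)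
  rw [show m + 1 - 1 - j = m - j by omega, Nat.choose_symm hj', Nat.sub_sub_self hj',
    binomialProb]
  ring

namespace IsUrnProcess

variable {Ω : Type*} [MeasurableSpace Ω] {μ : Measure Ω} {n : ℕ} {p : ℝ} {U : ℕ → Ω → ℕ}
  {hU : ∀ i, StronglyMeasurable (U i)}

theorem ae_le (h : IsUrnProcess μ n p U hU) (k : ℕ) : ∀ᵐ ω ∂μ, U k ω ≤ n := by
  induction k with
  | zero => exact h.1.mono fun ω hω => hω.le
  | succ k ih => filter_upwards [ih, h.2.1 k] with ω h₁ h₂ using h₂.trans h₁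

theorem integrable_comp [IsFiniteMeasure μ] (h : IsUrnProcess μ n p U hU) (k : ℕ) (g : ℕ → ℝ) :
    Integrable (fun ω => g (U k ω)) μ := by
  refine Integrable.of_bound
    ((measurable_from_nat (f := g)).comp (hU k).measurable).aestronglyMeasurable
    (∑ i ∈ Finset.range (n + 1), |g i|) ?_
  filter_upwards [h.ae_le k] with ω hω
  exact Finset.single_le_sum (f := fun i => |g i|) (fun i _ => abs_nonneg _)
    (Finset.mem_range.mpr (Nat.lt_succ_of_le hω))

/-- An eigenfunction of the transition operator is multiplied, in mean, by its eigenvalue at each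
step. -/
theorem integral_succ [IsProbabilityMeasure μ] (h : IsUrnProcess μ n p U hU) {g : ℕ → ℝ} {r : ℝ}
    (hg : ∀ m, ∑ j ∈ Finset.range (m + 1), g (m - j) * binomialProb m p j = r * g m) (k : ℕ) :
    ∫ ω, g (U (k + 1) ω) ∂μ = r * ∫ ω, g (U k ω) ∂μ := by
  let D : ℕ → Set Ω := fun j => {ω | U k ω - U (k + 1) ω = j}
  have hD : ∀ j, MeasurableSet (D j) := fun j =>
    ((hU k).measurable.sub (hU (k + 1)).measurable) (measurableSet_singleton j)
  have hint : ∀ j, Integrable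
      ((fun ω => g (U k ω - j)) * (D j).indicator fun _ => (1 : ℝ)) μ := fun j => by
    refine ((h.integrable_comp k fun m => g (m - j)).indicator (hD j)).congr (ae_of_all _ ?_)
    intro ω
    by_cases hω : ω ∈ D j <;> simp [hω]
  have hstep : ∀ j, ∫ ω, ((fun ω => g (U k ω - j)) * (D j).indicator fun _ => (1 : ℝ)) ω ∂μ =
      ∫ ω, g (U k ω - j) * binomialProb (U k ω) p j ∂μ := fun j => by
    have hm : StronglyMeasurable[Filtration.natural U hU k] fun ω => g (U k ω - j) :=
      ((measurable_from_nat (f := fun m => g (m - j))).comp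
        (Filtration.stronglyAdapted_natural hU k).measurable).stronglyMeasurable
    rw [← integral_condExp ((Filtration.natural U hU).le k)]
    refine integral_congr_ae ?_
    filter_upwards [condExp_mul_of_stronglyMeasurable_left hm (hint j)
      ((integrable_const (1 : ℝ)).indicator (hD j)), h.2.2 k j] with ω h₁ h₂
    rw [h₁, Pi.mul_apply, h₂]
  calc ∫ ω, g (U (k + 1) ω) ∂μ
      = ∫ ω, ∑ j ∈ Finset.range (n + 1),
          ((fun ω => g (U k ω - j)) * (D j).indicator fun _ => (1 : ℝ)) ω ∂μ := by
        refine integral_congr_ae ?_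
        filter_upwards [h.ae_le k, h.2.1 k] with ω h₁ h₂
        rw [Finset.sum_eq_single_of_mem (U k ω - U (k + 1) ω)
          (Finset.mem_range.mpr (by omega))]
        · simp [D, Nat.sub_sub_self h₂]
        · intro j _ hj
          simp [D, hj.symm]
    _ = ∫ ω, ∑ j ∈ Finset.range (n + 1), g (U k ω - j) * binomialProb (U k ω) p j ∂μ := by
        rw [integral_finsetSum _ fun j _ => hint j, integral_finsetSum _ fun j _ =>
          h.integrable_comp k fun m => g (m - j) * binomialProb m p j]
        exact Finset.sum_congr rfl fun j _ => hstep j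
    _ = ∫ ω, r * g (U k ω) ∂μ := by
        refine integral_congr_ae ?_
        filter_upwards [h.ae_le k] with ω hω
        rw [← hg]
        refine (Finset.sum_subset (Finset.range_mono (Nat.succ_le_succ hω)) ?_).symm
        intro j _ hj
        rw [binomialProb, Nat.choose_eq_zero_of_lt (by simpa using hj)]
        simp
    _ = r * ∫ ω, g (U k ω) ∂μ := integral_const_mul _ _

theorem integral_eq_pow_mul [IsProbabilityMeasure μ] (h : IsUrnProcess μ n p U hU) {g : ℕ → ℝ}
    {r : ℝ} (hg : ∀ m, ∑ j ∈ Finset.range (m + 1), g (m - j) * binomialProb m p j = r * g m)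
    (k : ℕ) : ∫ ω, g (U k ω) ∂μ = r ^ k * g n := by
  induction k with
  | zero =>
    rw [integral_congr_ae (h.1.mono fun ω hω => show g (U 0 ω) = g n by rw [hω])]
    simp
  | succ k ih => rw [h.integral_succ hg, ih]; ring

theorem variance_eq [IsProbabilityMeasure μ] (h : IsUrnProcess μ n p U hU) (k : ℕ) :
    variance (fun ω => (U k ω : ℝ)) μ = n * ((1 - p) ^ k * (1 - (1 - p) ^ k)) := by
  have hcast : ∀ m : ℕ, ((m * (m - 1) : ℕ) : ℝ) = (m : ℝ) * m - m := fun m => by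
    rw [Nat.mul_sub_one, Nat.cast_sub (Nat.le_mul_self m), Nat.cast_mul]
  have h₁ := h.integral_eq_pow_mul (g := fun m => (m : ℝ))
    (fun m => sum_sub_mul_binomialProb m p) k
  have h₂ := h.integral_eq_pow_mul (g := fun m => ((m * (m - 1) : ℕ) : ℝ))
    (fun m => sum_factorial_moment_mul_binomialProb m p) k
  simp only [hcast] at h₂
  rw [integral_sub (h.integrable_comp k fun m => (m : ℝ) * m)
    (h.integrable_comp k fun m => (m : ℝ)), h₁] at h₂
  have hL : MemLp (fun ω => (U k ω : ℝ)) 2 μ := by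
    rw [memLp_two_iff_integrable_sq
      (h.integrable_comp k fun m => (m : ℝ)).aestronglyMeasurable]
    exact h.integrable_comp k fun m => (m : ℝ) ^ 2
  rw [variance_eq_sub hL, h₁]
  simp only [Pi.pow_apply, pow_two] at h₂ ⊢
  rw [eq_add_of_sub_eq h₂, mul_pow]
  ring

end IsUrnProcess

/-- Replacing `1 - p` by `exp (-p)` changes its `k`-th power by at most `k * p ^ 2`. -/
theorem abs_one_sub_pow_sub_exp_le {p : ℝ} (hp : 0 ≤ p) (hp' : p ≤ 1) (k : ℕ) :
    |(1 - p) ^ k - Real.exp (-p) ^ k| ≤ k * p ^ 2 := by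
  induction k with
  | zero => simp
  | succ k ih =>
    have h₁ : |Real.exp (-p) - 1 - -p| ≤ (-p) ^ 2 :=
      Real.abs_exp_sub_one_sub_id_le (by rwa [abs_neg, abs_of_nonneg hp])
    have h₂ : |Real.exp (-p) ^ k| ≤ 1 := by
      rw [abs_of_nonneg (by positivity)]
      exact pow_le_one₀ (by positivity) (Real.exp_le_one_iff.mpr (by linarith))
    calc |(1 - p) ^ (k + 1) - Real.exp (-p) ^ (k + 1)|
        = |(1 - p) * ((1 - p) ^ k - Real.exp (-p) ^ k) -
            Real.exp (-p) ^ k * (Real.exp (-p) - 1 - -p)| := by ring_nf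
      _ ≤ |1 - p| * |(1 - p) ^ k - Real.exp (-p) ^ k| +
            |Real.exp (-p) ^ k| * |Real.exp (-p) - 1 - -p| := by
          rw [← abs_mul, ← abs_mul]; exact abs_sub _ _
      _ ≤ 1 * (k * p ^ 2) + 1 * (-p) ^ 2 := by
          gcongr
          rw [abs_of_nonneg (by linarith)]; linarith
      _ = (k + 1 : ℕ) * p ^ 2 := by push_cast; ring

theorem abs_mul_one_sub_sub_le {x y : ℝ} (hx : x ∈ Set.Icc (0 : ℝ) 1)
    (hy : y ∈ Set.Icc (0 : ℝ) 1) : |x * (1 - x) - y * (1 - y)| ≤ |x - y| := by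
  rw [show x * (1 - x) - y * (1 - y) = (x - y) * (1 - x - y) by ring, abs_mul]
  refine mul_le_of_le_one_right (abs_nonneg _) (abs_le.mpr ⟨?_, ?_⟩) <;>
    linarith [hx.1, hx.2, hy.1, hy.2]

/-- Let `c > 0`.  For the urn process with parameters `n` and `p = c/n`, the
variance of `U k / √n` satisfies: there is a constant `C > 0` (depending only
on `c`) such that for all integers `n > 2c` and all `0 ≤ k ≤ n`,
`|Var(U k)/n - e^{-ck/n}(1 - e^{-ck/n})| ≤ C / n`. -/
theorem urn_variance_over_n_approx (c : ℝ) (hc : 0 < c) :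
    ∃ C : ℝ, 0 < C ∧
      ∀ (Ω : Type) [MeasurableSpace Ω] (μ : Measure Ω) [IsProbabilityMeasure μ]
        (n : ℕ), 2 * c < (n : ℝ) →
        ∀ (U : ℕ → Ω → ℕ) (hU : ∀ i, StronglyMeasurable (U i)),
          IsUrnProcess μ n (c / n) U hU →
          ∀ k : ℕ, k ≤ n →
            |variance (fun ω => (U k ω : ℝ)) μ / n
              - Real.exp (-(c * k) / n) * (1 - Real.exp (-(c * k) / n))| ≤ C / n := by
  refine ⟨c ^ 2, by positivity, fun Ω _ μ _ n hn U hU h k hk => ?_⟩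
  have hn₀ : (0 : ℝ) < n := by linarith
  have hp : 0 ≤ c / n := by positivity
  have hp' : c / n ≤ 1 := (div_le_one hn₀).mpr (by linarith)
  have hexp : Real.exp (-(c * k) / n) = Real.exp (-(c / n)) ^ k := by
    rw [← Real.exp_nat_mul]; congr 1; ring
  rw [h.variance_eq, mul_div_cancel_left₀ _ hn₀.ne', hexp]
  calc _ ≤ |(1 - c / n) ^ k - Real.exp (-(c / n)) ^ k| :=
        abs_mul_one_sub_sub_le
          ⟨pow_nonneg (by linarith) _, pow_le_one₀ (by linarith) (by linarith)⟩
          ⟨by positivity, pow_le_one₀ (by positivity) (Real.exp_le_one_iff.mpr (by linarith))⟩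
    _ ≤ k * (c / n) ^ 2 := abs_one_sub_pow_sub_exp_le hp hp' k
    _ ≤ n * (c / n) ^ 2 := by gcongr
    _ = c ^ 2 / n := by field_simp
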